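/- arXiv:1508.01835 — 6 statements merged into one kernel-verified Lean document; each statement's English description precedes it below -/
import Mathlib

section
/- For all vectors x₀ ∈ ℝ^{m₀}, x₁ ∈ ℝ^{m₁}, b₀ ∈ ℝ^{m₀}, b₁ ∈ ℝ^{m₁}: the pair (x₀, x₁) satisfies A·(x₀; x₁) = (b₀; b₁) if and only if there exist w ∈ ℝ^r and z ∈ ℝ^s such that E·(x₀; x₁; w; z) = (b₀; b₁; 0; 0). Moreover, any (x₀, x₁, w, z) satisfying E·(x₀; x₁; w; z) = (b₀; b₁; 0; 0) necessarily has w = V₁ᵀx₁ and z = V₀ᵀx₀. -/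
open Matrix

/-- Equivalence between the two-level `H²`-matrix system `A·(x₀;x₁) = (b₀;b₁)`
and the extended sparse system `E·(x₀;x₁;w;z) = (b₀;b₁;0;0)`, together with the fact that
any solution of the extended system has `w = V₁ᵀx₁` and `z = V₀ᵀx₀`. -/
theorem extended_sparsification_two_level
    (m₀ m₁ r s : ℕ)
    (A₀₀ : Matrix (Fin m₀) (Fin m₀) ℝ) (A₁₁ : Matrix (Fin m₁) (Fin m₁) ℝ)
    (U₀ : Matrix (Fin m₀) (Fin r) ℝ) (V₁ : Matrix (Fin m₁) (Fin r) ℝ)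
    (U₁ : Matrix (Fin m₁) (Fin s) ℝ) (V₀ : Matrix (Fin m₀) (Fin s) ℝ)
    (A : Matrix (Fin m₀ ⊕ Fin m₁) (Fin m₀ ⊕ Fin m₁) ℝ)
    (hA : A = fromBlocks A₀₀ (U₀ * V₁ᵀ) (U₁ * V₀ᵀ) A₁₁)
    (E : Matrix ((Fin m₀ ⊕ Fin m₁) ⊕ (Fin s ⊕ Fin r))
                ((Fin m₀ ⊕ Fin m₁) ⊕ (Fin r ⊕ Fin s)) ℝ)
    (hE : E = fromBlocks (fromBlocks A₀₀ 0 0 A₁₁) (fromBlocks U₀ 0 0 U₁)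
      (fromBlocks V₀ᵀ 0 0 V₁ᵀ) (fromBlocks 0 (-1) (-1) 0))
    (x₀ b₀ : Fin m₀ → ℝ) (x₁ b₁ : Fin m₁ → ℝ) :
    (A *ᵥ Sum.elim x₀ x₁ = Sum.elim b₀ b₁ ↔
      ∃ (w : Fin r → ℝ) (z : Fin s → ℝ),
        E *ᵥ Sum.elim (Sum.elim x₀ x₁) (Sum.elim w z)
          = Sum.elim (Sum.elim b₀ b₁) 0) ∧
    (∀ (w : Fin r → ℝ) (z : Fin s → ℝ),
      E *ᵥ Sum.elim (Sum.elim x₀ x₁) (Sum.elim w z) = Sum.elim (Sum.elim b₀ b₁) 0 →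
        w = V₁ᵀ *ᵥ x₁ ∧ z = V₀ᵀ *ᵥ x₀) := by
  have hext : ∀ (w : Fin r → ℝ) (z : Fin s → ℝ),
      E *ᵥ Sum.elim (Sum.elim x₀ x₁) (Sum.elim w z) = Sum.elim (Sum.elim b₀ b₁) 0 ↔
        (A₀₀ *ᵥ x₀ + U₀ *ᵥ w = b₀ ∧ A₁₁ *ᵥ x₁ + U₁ *ᵥ z = b₁) ∧
          w = V₁ᵀ *ᵥ x₁ ∧ z = V₀ᵀ *ᵥ x₀ := by
    intro w z
    rw [hE, ← Sum.elim_zero_zero]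
    simp only [fromBlocks_mulVec, Sum.elim_comp_inl, Sum.elim_comp_inr, ← Sum.elim_add_add,
      Sum.elim_eq_iff, zero_mulVec, neg_mulVec, one_mulVec, add_zero, zero_add,
      add_neg_eq_zero]
    tauto
  have hred : A *ᵥ Sum.elim x₀ x₁ = Sum.elim b₀ b₁ ↔
      A₀₀ *ᵥ x₀ + U₀ *ᵥ (V₁ᵀ *ᵥ x₁) = b₀ ∧ A₁₁ *ᵥ x₁ + U₁ *ᵥ (V₀ᵀ *ᵥ x₀) = b₁ := by
    rw [hA]
    simp only [fromBlocks_mulVec, Sum.elim_comp_inl, Sum.elim_comp_inr, Sum.elim_eq_iff,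
      mulVec_mulVec, add_comm (A₁₁ *ᵥ x₁)]
  refine ⟨?_, fun w z h => ((hext w z).1 h).2⟩
  rw [hred]
  constructor
  · exact fun h => ⟨_, _, (hext _ _).2 ⟨h, rfl, rfl⟩⟩
  · rintro ⟨w, z, h⟩
    obtain ⟨h, rfl, rfl⟩ := (hext w z).1 h
    exact h
end

section
/- The extended sparse matrix E is invertible if and only if the two-level H²-matrix A is invertible. (No invertibility assumptions on the individual blocks A₀₀, A₁₁ are needed.) -/
open Matrix

/-- Schur complement criterion for a block matrix whose lower right block `J` is invertible with
inverse `N`, where the rows and columns of `J` may be indexed by different types. -/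
theorem Matrix.exists_inverse_fromBlocks_iff_isUnit_schur {R n p q : Type*} [CommRing R]
    [Fintype n] [DecidableEq n] [Fintype p] [DecidableEq p] [Fintype q] [DecidableEq q]
    (e : p ≃ q) (D : Matrix n n R) (U : Matrix n q R) (V : Matrix p n R)
    (J : Matrix p q R) (N : Matrix q p R) (hJN : J * N = 1) :
    (∃ F : Matrix (n ⊕ q) (n ⊕ p) R,
      fromBlocks D U V J * F = 1 ∧ F * fromBlocks D U V J = 1) ↔
      IsUnit (D - U * N * V) := by
  have hNJ : N * J = 1 := (mul_eq_one_comm_of_equiv e).1 hJN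
  constructor
  · rintro ⟨F, hF, -⟩
    rw [← fromBlocks_toBlocks F, fromBlocks_multiply, ← fromBlocks_one, fromBlocks_inj] at hF
    obtain ⟨h₁, -, h₂, -⟩ := hF
    have h₃ : N * V * F.toBlocks₁₁ = -F.toBlocks₂₁ := by
      rw [Matrix.mul_assoc, eq_neg_of_add_eq_zero_left h₂, Matrix.mul_neg, ← Matrix.mul_assoc, hNJ,
        Matrix.one_mul]
    refine IsUnit.of_mul_eq_one F.toBlocks₁₁ ?_
    rw [Matrix.sub_mul, Matrix.mul_assoc U, Matrix.mul_assoc U, h₃, Matrix.mul_neg, sub_neg_eq_add,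
      h₁]
  · intro h
    obtain ⟨B, hB⟩ := h.exists_right_inv
    have hB' : D * B = 1 + U * (N * (V * B)) := by
      rw [Matrix.sub_mul, sub_eq_iff_eq_add] at hB
      simpa only [Matrix.mul_assoc] using hB
    have hF : fromBlocks D U V J *
        fromBlocks B (-(B * (U * N))) (-(N * (V * B))) (N + N * (V * (B * (U * N)))) = 1 := by
      rw [fromBlocks_multiply, ← fromBlocks_one, fromBlocks_inj]
      refine ⟨?_, ?_, ?_, ?_⟩
      · rw [hB', Matrix.mul_neg, add_neg_cancel_right]
      · rw [Matrix.mul_neg, ← Matrix.mul_assoc D, hB']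
        simp only [Matrix.add_mul, Matrix.mul_add, Matrix.one_mul, Matrix.mul_assoc]
        exact neg_add_cancel _
      · rw [Matrix.mul_neg, ← Matrix.mul_assoc J, hJN, Matrix.one_mul, add_neg_cancel]
      · rw [Matrix.mul_neg, Matrix.mul_add, ← Matrix.mul_assoc J, hJN, Matrix.one_mul]
        abel
    exact ⟨_, hF, (mul_eq_one_comm_of_equiv ((Equiv.refl n).sumCongr e)).1 hF⟩

/-- The extended sparse matrix `E` (which is square of total size
`m₀+m₁+r+s`, with row blocks `(m₀,m₁,s,r)` and column blocks `(m₀,m₁,r,s)`) is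
invertible — i.e., it has a two-sided inverse — if and only if the two-level
`H²`-matrix `A` is invertible. No invertibility of `A₀₀`, `A₁₁` is assumed. -/
theorem extended_sparse_invertible_iff_two_level
    (m₀ m₁ r s : ℕ)
    (A₀₀ : Matrix (Fin m₀) (Fin m₀) ℝ) (A₁₁ : Matrix (Fin m₁) (Fin m₁) ℝ)
    (U₀ : Matrix (Fin m₀) (Fin r) ℝ) (V₁ : Matrix (Fin m₁) (Fin r) ℝ)
    (U₁ : Matrix (Fin m₁) (Fin s) ℝ) (V₀ : Matrix (Fin m₀) (Fin s) ℝ)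
    (A : Matrix (Fin m₀ ⊕ Fin m₁) (Fin m₀ ⊕ Fin m₁) ℝ)
    (hA : A = fromBlocks A₀₀ (U₀ * V₁ᵀ) (U₁ * V₀ᵀ) A₁₁)
    (E : Matrix ((Fin m₀ ⊕ Fin m₁) ⊕ (Fin s ⊕ Fin r))
                ((Fin m₀ ⊕ Fin m₁) ⊕ (Fin r ⊕ Fin s)) ℝ)
    (hE : E = fromBlocks (fromBlocks A₀₀ 0 0 A₁₁) (fromBlocks U₀ 0 0 U₁)
      (fromBlocks V₀ᵀ 0 0 V₁ᵀ) (fromBlocks 0 (-1) (-1) 0)) :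
    (∃ F : Matrix ((Fin m₀ ⊕ Fin m₁) ⊕ (Fin r ⊕ Fin s))
                  ((Fin m₀ ⊕ Fin m₁) ⊕ (Fin s ⊕ Fin r)) ℝ,
      E * F = 1 ∧ F * E = 1) ↔ IsUnit A := by
  subst hA hE
  rw [exists_inverse_fromBlocks_iff_isUnit_schur (Equiv.sumComm _ _) _ _ _ _
    (fromBlocks 0 (-1) (-1) 0) (by simp [fromBlocks_multiply])]
  simp [fromBlocks_multiply, sub_eq_add_neg, fromBlocks_neg, fromBlocks_add]
end

section
/- The rank of the extended sparse matrix E equals the rank of the two-level H²-matrix A plus r + s, i.e., rank(E) = rank(A) + r + s. Equivalently, the kernels of E and A have the same dimension, via the linear bijection x = (x₀, x₁) ↦ (x₀, x₁, V₁ᵀx₁, V₀ᵀx₀) from ker(A) onto ker(E). -/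
open Matrix

/-- If an injective linear map carries the kernel of `M` onto the kernel of `N`, then `M` and `N`
have the same nullity. -/
theorem Matrix.rank_add_card_eq_of_ker_eq_map {K m n m' n' : Type*} [Field K]
    [Fintype n] [Fintype n'] (M : Matrix m n K) (N : Matrix m' n' K)
    (f : (n → K) →ₗ[K] (n' → K)) (hf : Function.Injective f)
    (h : N.mulVecLin.ker = M.mulVecLin.ker.map f) :
    N.rank + Fintype.card n = M.rank + Fintype.card n' := by
  have hM := M.mulVecLin.finrank_range_add_finrank_ker
  have hN := N.mulVecLin.finrank_range_add_finrank_ker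
  have hker := (Submodule.equivMapOfInjective f hf M.mulVecLin.ker).finrank_eq
  rw [h, ← hker, Module.finrank_fintype_fun_eq_card] at hN
  rw [Module.finrank_fintype_fun_eq_card] at hM
  unfold Matrix.rank
  omega

/-- `rank(E) = rank(A) + r + s`, and the kernel of `E` is exactly the image
of the kernel of `A` under the (injective) linear map
`(x₀, x₁) ↦ (x₀, x₁, V₁ᵀx₁, V₀ᵀx₀)`. -/
theorem extended_sparse_rank_two_level
    (m₀ m₁ r s : ℕ)
    (A₀₀ : Matrix (Fin m₀) (Fin m₀) ℝ) (A₁₁ : Matrix (Fin m₁) (Fin m₁) ℝ)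
    (U₀ : Matrix (Fin m₀) (Fin r) ℝ) (V₁ : Matrix (Fin m₁) (Fin r) ℝ)
    (U₁ : Matrix (Fin m₁) (Fin s) ℝ) (V₀ : Matrix (Fin m₀) (Fin s) ℝ)
    (A : Matrix (Fin m₀ ⊕ Fin m₁) (Fin m₀ ⊕ Fin m₁) ℝ)
    (hA : A = fromBlocks A₀₀ (U₀ * V₁ᵀ) (U₁ * V₀ᵀ) A₁₁)
    (E : Matrix ((Fin m₀ ⊕ Fin m₁) ⊕ (Fin s ⊕ Fin r))
                ((Fin m₀ ⊕ Fin m₁) ⊕ (Fin r ⊕ Fin s)) ℝ)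
    (hE : E = fromBlocks (fromBlocks A₀₀ 0 0 A₁₁) (fromBlocks U₀ 0 0 U₁)
      (fromBlocks V₀ᵀ 0 0 V₁ᵀ) (fromBlocks 0 (-1) (-1) 0)) :
    E.rank = A.rank + r + s ∧
    ∀ (x₀ : Fin m₀ → ℝ) (x₁ : Fin m₁ → ℝ) (w : Fin r → ℝ) (z : Fin s → ℝ),
      E *ᵥ Sum.elim (Sum.elim x₀ x₁) (Sum.elim w z) = 0 ↔
        (A *ᵥ Sum.elim x₀ x₁ = 0 ∧ w = V₁ᵀ *ᵥ x₁ ∧ z = V₀ᵀ *ᵥ x₀) := by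
  have hker : ∀ (x₀ : Fin m₀ → ℝ) (x₁ : Fin m₁ → ℝ) (w : Fin r → ℝ) (z : Fin s → ℝ),
      E *ᵥ Sum.elim (Sum.elim x₀ x₁) (Sum.elim w z) = 0 ↔
        (A *ᵥ Sum.elim x₀ x₁ = 0 ∧ w = V₁ᵀ *ᵥ x₁ ∧ z = V₀ᵀ *ᵥ x₀) := by
    intro x₀ x₁ w z
    have hzero {α β : Type} (u : α → ℝ) (v : β → ℝ) : Sum.elim u v = 0 ↔ u = 0 ∧ v = 0 := by
      rw [← Sum.elim_zero_zero, Sum.elim_eq_iff]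
    have hadd {α β : Type} (u u' : α → ℝ) (v v' : β → ℝ) :
        Sum.elim u v + Sum.elim u' v' = Sum.elim (u + u') (v + v') := by
      ext (i | i) <;> rfl
    simp only [hA, hE, fromBlocks_mulVec, Sum.elim_comp_inl, Sum.elim_comp_inr, hadd, hzero,
      zero_mulVec, add_zero, zero_add, neg_mulVec, one_mulVec, add_neg_eq_zero,
      ← mulVec_mulVec]
    constructor
    · rintro ⟨⟨h₀, h₁⟩, rfl, rfl⟩
      exact ⟨⟨h₀, by rwa [add_comm]⟩, rfl, rfl⟩
    · rintro ⟨⟨h₀, h₁⟩, rfl, rfl⟩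
      exact ⟨⟨h₀, by rwa [add_comm]⟩, rfl, rfl⟩
  refine ⟨?_, hker⟩
  let F : Matrix ((Fin m₀ ⊕ Fin m₁) ⊕ (Fin r ⊕ Fin s)) (Fin m₀ ⊕ Fin m₁) ℝ :=
    fromRows 1 (fromBlocks 0 V₁ᵀ V₀ᵀ 0)
  have hF (x₀ : Fin m₀ → ℝ) (x₁ : Fin m₁ → ℝ) : F.mulVecLin (Sum.elim x₀ x₁) =
      Sum.elim (Sum.elim x₀ x₁) (Sum.elim (V₁ᵀ *ᵥ x₁) (V₀ᵀ *ᵥ x₀)) := by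
    simp [F, fromRows_mulVec, fromBlocks_mulVec]
  have hinj : Function.Injective F.mulVecLin := by
    intro x y hxy
    rw [← Sum.elim_comp_inl_inr x, ← Sum.elim_comp_inl_inr y, hF, hF] at hxy
    simpa only [Sum.elim_comp_inl_inr] using (Sum.elim_eq_iff.mp hxy).1
  have hmap : E.mulVecLin.ker = A.mulVecLin.ker.map F.mulVecLin := by
    ext v
    obtain ⟨x₀, x₁, w, z, rfl⟩ : ∃ x₀ x₁ w z, v = Sum.elim (Sum.elim x₀ x₁) (Sum.elim w z) :=
      ⟨v ∘ Sum.inl ∘ Sum.inl, v ∘ Sum.inl ∘ Sum.inr, v ∘ Sum.inr ∘ Sum.inl, v ∘ Sum.inr ∘ Sum.inr,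
        by ext ((i | i) | (i | i)) <;> rfl⟩
    rw [LinearMap.mem_ker, mulVecLin_apply, hker, Submodule.mem_map]
    constructor
    · rintro ⟨h, rfl, rfl⟩
      exact ⟨_, h, hF x₀ x₁⟩
    · rintro ⟨y, hy, hyv⟩
      rw [← Sum.elim_comp_inl_inr y] at hy hyv
      rw [hF] at hyv
      simp only [Sum.elim_eq_iff] at hyv
      obtain ⟨⟨rfl, rfl⟩, rfl, rfl⟩ := hyv
      exact ⟨hy, rfl, rfl⟩
  have hrank := rank_add_card_eq_of_ker_eq_map A E F.mulVecLin hinj hmap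
  simp only [Fintype.card_sum, Fintype.card_fin] at hrank
  omega
end

section
/- Assume A₀₀ and A₁₁ are invertible. For b₀ ∈ ℝ^{m₀}, b₁ ∈ ℝ^{m₁} set g₀ = V₀ᵀA₀₀⁻¹b₀ and g₁ = V₁ᵀA₁₁⁻¹b₁. Then (x₀, x₁) solves A·(x₀; x₁) = (b₀; b₁) if and only if the pair (w, z) := (V₁ᵀx₁, V₀ᵀx₀) solves the reduced auxiliary system [[−C₀, −I_s], [−I_r, −C₁]]·(w; z) = (−g₀; −g₁) and x₀ = A₀₀⁻¹(b₀ − U₀w), x₁ = A₁₁⁻¹(b₁ − U₁z). -/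
open Matrix

theorem Matrix.eq_inv_mulVec_iff {n R : Type*} [Fintype n] [DecidableEq n] [CommRing R]
    {M : Matrix n n R} (hM : IsUnit M) (x y : n → R) : x = M⁻¹ *ᵥ y ↔ M *ᵥ x = y := by
  have hdet : IsUnit M.det := (Matrix.isUnit_iff_isUnit_det M).mp hM
  constructor
  · rintro rfl
    rw [mulVec_mulVec, mul_nonsing_inv _ hdet, one_mulVec]
  · rintro rfl
    rw [mulVec_mulVec, nonsing_inv_mul _ hdet, one_mulVec]

/-- Applying `Vᵀ` to `x = M⁻¹(b − U w)` gives one row of the reduced system. -/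
theorem Matrix.transpose_mulVec_eq_sub {n k l R : Type*} [Fintype n] [DecidableEq n]
    [Fintype k] [CommRing R] {M : Matrix n n R} {U : Matrix n k R} {V : Matrix n l R}
    {x b : n → R} {w : k → R} (hx : x = M⁻¹ *ᵥ (b - U *ᵥ w)) :
    Vᵀ *ᵥ x = Vᵀ *ᵥ (M⁻¹ *ᵥ b) - (Vᵀ * M⁻¹ * U) *ᵥ w := by
  rw [hx]
  simp only [mulVec_sub, mulVec_mulVec, Matrix.mul_assoc]

/-- If `A₀₀` and `A₁₁` are invertible, with `C₀ = V₀ᵀA₀₀⁻¹U₀`,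
`C₁ = V₁ᵀA₁₁⁻¹U₁`, `g₀ = V₀ᵀA₀₀⁻¹b₀`, `g₁ = V₁ᵀA₁₁⁻¹b₁`, then `(x₀, x₁)` solves
`A·(x₀;x₁) = (b₀;b₁)` iff `(w, z) := (V₁ᵀx₁, V₀ᵀx₀)` solves the reduced auxiliary
system `[[−C₀, −I_s], [−I_r, −C₁]]·(w;z) = (−g₀;−g₁)` and
`x₀ = A₀₀⁻¹(b₀ − U₀w)`, `x₁ = A₁₁⁻¹(b₁ − U₁z)`. -/
theorem two_level_reduced_auxiliary_system
    (m₀ m₁ r s : ℕ)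
    (A₀₀ : Matrix (Fin m₀) (Fin m₀) ℝ) (A₁₁ : Matrix (Fin m₁) (Fin m₁) ℝ)
    (U₀ : Matrix (Fin m₀) (Fin r) ℝ) (V₁ : Matrix (Fin m₁) (Fin r) ℝ)
    (U₁ : Matrix (Fin m₁) (Fin s) ℝ) (V₀ : Matrix (Fin m₀) (Fin s) ℝ)
    (hA₀₀ : IsUnit A₀₀) (hA₁₁ : IsUnit A₁₁)
    (A : Matrix (Fin m₀ ⊕ Fin m₁) (Fin m₀ ⊕ Fin m₁) ℝ)
    (hA : A = fromBlocks A₀₀ (U₀ * V₁ᵀ) (U₁ * V₀ᵀ) A₁₁)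
    (C₀ : Matrix (Fin s) (Fin r) ℝ) (hC₀ : C₀ = V₀ᵀ * A₀₀⁻¹ * U₀)
    (C₁ : Matrix (Fin r) (Fin s) ℝ) (hC₁ : C₁ = V₁ᵀ * A₁₁⁻¹ * U₁)
    (b₀ x₀ : Fin m₀ → ℝ) (b₁ x₁ : Fin m₁ → ℝ)
    (g₀ : Fin s → ℝ) (hg₀ : g₀ = V₀ᵀ *ᵥ (A₀₀⁻¹ *ᵥ b₀))
    (g₁ : Fin r → ℝ) (hg₁ : g₁ = V₁ᵀ *ᵥ (A₁₁⁻¹ *ᵥ b₁)) :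
    A *ᵥ Sum.elim x₀ x₁ = Sum.elim b₀ b₁ ↔
      (fromBlocks (-C₀) (-1) (-1) (-C₁) *ᵥ
          Sum.elim (V₁ᵀ *ᵥ x₁) (V₀ᵀ *ᵥ x₀) = Sum.elim (-g₀) (-g₁) ∧
        x₀ = A₀₀⁻¹ *ᵥ (b₀ - U₀ *ᵥ (V₁ᵀ *ᵥ x₁)) ∧
        x₁ = A₁₁⁻¹ *ᵥ (b₁ - U₁ *ᵥ (V₀ᵀ *ᵥ x₀))) := by
  subst hA hC₀ hC₁ hg₀ hg₁
  have key : fromBlocks A₀₀ (U₀ * V₁ᵀ) (U₁ * V₀ᵀ) A₁₁ *ᵥ Sum.elim x₀ x₁ = Sum.elim b₀ b₁ ↔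
      x₀ = A₀₀⁻¹ *ᵥ (b₀ - U₀ *ᵥ (V₁ᵀ *ᵥ x₁)) ∧
        x₁ = A₁₁⁻¹ *ᵥ (b₁ - U₁ *ᵥ (V₀ᵀ *ᵥ x₀)) := by
    rw [eq_inv_mulVec_iff hA₀₀, eq_inv_mulVec_iff hA₁₁, fromBlocks_mulVec, Sum.elim_eq_iff,
      eq_sub_iff_add_eq, eq_sub_iff_add_eq, Sum.elim_comp_inl, Sum.elim_comp_inr,
      mulVec_mulVec, mulVec_mulVec, add_comm ((U₁ * V₀ᵀ) *ᵥ x₀)]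
  rw [key]
  refine ⟨fun h => ⟨?_, h⟩, And.right⟩
  have h₀ := transpose_mulVec_eq_sub (V := V₀) h.1
  have h₁ := transpose_mulVec_eq_sub (V := V₁) h.2
  rw [fromBlocks_mulVec, Sum.elim_eq_iff, Sum.elim_comp_inl, Sum.elim_comp_inr]
  simp only [neg_mulVec, one_mulVec]
  constructor
  · rw [h₀]
    abel
  · nth_rewrite 1 [h₁]
    abel
end

section
/- Assume A₀₀ and A₁₁ are invertible. Then the two-level H²-matrix A is invertible if and only if the matrix I_r − C₁C₀ is invertible, which in turn holds if and only if I_s − C₀C₁ is invertible. -/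
open Matrix

/-- If `A₀₀` and `A₁₁` are invertible, then the two-level `H²`-matrix
`A` is invertible iff `I_r − C₁C₀` is invertible, which holds iff `I_s − C₀C₁` is
invertible (with `C₀ = V₀ᵀA₀₀⁻¹U₀`, `C₁ = V₁ᵀA₁₁⁻¹U₁`). -/
theorem two_level_invertibility_criterion
    (m₀ m₁ r s : ℕ)
    (A₀₀ : Matrix (Fin m₀) (Fin m₀) ℝ) (A₁₁ : Matrix (Fin m₁) (Fin m₁) ℝ)
    (U₀ : Matrix (Fin m₀) (Fin r) ℝ) (V₁ : Matrix (Fin m₁) (Fin r) ℝ)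
    (U₁ : Matrix (Fin m₁) (Fin s) ℝ) (V₀ : Matrix (Fin m₀) (Fin s) ℝ)
    (hA₀₀ : IsUnit A₀₀) (hA₁₁ : IsUnit A₁₁)
    (A : Matrix (Fin m₀ ⊕ Fin m₁) (Fin m₀ ⊕ Fin m₁) ℝ)
    (hA : A = fromBlocks A₀₀ (U₀ * V₁ᵀ) (U₁ * V₀ᵀ) A₁₁)
    (C₀ : Matrix (Fin s) (Fin r) ℝ) (hC₀ : C₀ = V₀ᵀ * A₀₀⁻¹ * U₀)
    (C₁ : Matrix (Fin r) (Fin s) ℝ) (hC₁ : C₁ = V₁ᵀ * A₁₁⁻¹ * U₁) :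
    (IsUnit A ↔ IsUnit (1 - C₁ * C₀)) ∧
    (IsUnit (1 - C₁ * C₀) ↔ IsUnit (1 - C₀ * C₁)) := by
  subst hA hC₀ hC₁
  have hdet : IsUnit A₁₁.det := (isUnit_iff_isUnit_det A₁₁).1 hA₁₁
  constructor
  · have := hA₀₀.invertible
    have schur : A₁₁ - U₁ * V₀ᵀ * ⅟A₀₀ * (U₀ * V₁ᵀ)
        = A₁₁ + (-(U₁ * (V₀ᵀ * A₀₀⁻¹ * U₀))) * V₁ᵀ := by
      rw [invOf_eq_nonsing_inv]
      simp only [Matrix.neg_mul, Matrix.mul_assoc, sub_eq_add_neg]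
    have small : 1 + V₁ᵀ * A₁₁⁻¹ * (-(U₁ * (V₀ᵀ * A₀₀⁻¹ * U₀)))
        = 1 - V₁ᵀ * A₁₁⁻¹ * U₁ * (V₀ᵀ * A₀₀⁻¹ * U₀) := by
      simp only [Matrix.mul_neg, Matrix.mul_assoc, sub_eq_add_neg]
    rw [isUnit_fromBlocks_iff_of_invertible₁₁, schur, isUnit_iff_isUnit_det,
      det_add_mul _ _ hdet, small, IsUnit.mul_iff, ← isUnit_iff_isUnit_det (1 - _)]
    exact and_iff_right hdet
  · rw [isUnit_iff_isUnit_det, isUnit_iff_isUnit_det, det_one_sub_mul_comm]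
end

section
/- Assume A₀₀, A₁₁, and I_r − C₁C₀ are invertible. Then A is invertible, and for any b₀ ∈ ℝ^{m₀}, b₁ ∈ ℝ^{m₁}, the unique solution of A·(x₀; x₁) = (b₀; b₁) is given explicitly by: with g₀ = V₀ᵀA₀₀⁻¹b₀ and g₁ = V₁ᵀA₁₁⁻¹b₁, set w = (I_r − C₁C₀)⁻¹(g₁ − C₁g₀) and z = g₀ − C₀w; then x₀ = A₀₀⁻¹(b₀ − U₀w) and x₁ = A₁₁⁻¹(b₁ − U₁z). -/
open Matrix

/-- If `A₀₀`, `A₁₁`, and `I_r − C₁C₀` are invertible, then `A` is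
invertible, and for every right-hand side `(b₀, b₁)` the unique solution of
`A·(x₀;x₁) = (b₀;b₁)` is given by the explicit IFMM elimination/back-substitution
formulas: `g₀ = V₀ᵀA₀₀⁻¹b₀`, `g₁ = V₁ᵀA₁₁⁻¹b₁`, `w = (I_r − C₁C₀)⁻¹(g₁ − C₁g₀)`,
`z = g₀ − C₀w`, `x₀ = A₀₀⁻¹(b₀ − U₀w)`, `x₁ = A₁₁⁻¹(b₁ − U₁z)`. -/
theorem two_level_ifmm_explicit_solution
    (m₀ m₁ r s : ℕ)
    (A₀₀ : Matrix (Fin m₀) (Fin m₀) ℝ) (A₁₁ : Matrix (Fin m₁) (Fin m₁) ℝ)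
    (U₀ : Matrix (Fin m₀) (Fin r) ℝ) (V₁ : Matrix (Fin m₁) (Fin r) ℝ)
    (U₁ : Matrix (Fin m₁) (Fin s) ℝ) (V₀ : Matrix (Fin m₀) (Fin s) ℝ)
    (hA₀₀ : IsUnit A₀₀) (hA₁₁ : IsUnit A₁₁)
    (A : Matrix (Fin m₀ ⊕ Fin m₁) (Fin m₀ ⊕ Fin m₁) ℝ)
    (hA : A = fromBlocks A₀₀ (U₀ * V₁ᵀ) (U₁ * V₀ᵀ) A₁₁)
    (C₀ : Matrix (Fin s) (Fin r) ℝ) (hC₀ : C₀ = V₀ᵀ * A₀₀⁻¹ * U₀)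
    (C₁ : Matrix (Fin r) (Fin s) ℝ) (hC₁ : C₁ = V₁ᵀ * A₁₁⁻¹ * U₁)
    (hS : IsUnit (1 - C₁ * C₀)) :
    IsUnit A ∧
    ∀ (b₀ : Fin m₀ → ℝ) (b₁ : Fin m₁ → ℝ),
      let g₀ := V₀ᵀ *ᵥ (A₀₀⁻¹ *ᵥ b₀)
      let g₁ := V₁ᵀ *ᵥ (A₁₁⁻¹ *ᵥ b₁)
      let w := (1 - C₁ * C₀)⁻¹ *ᵥ (g₁ - C₁ *ᵥ g₀)
      let z := g₀ - C₀ *ᵥ w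
      let x₀ := A₀₀⁻¹ *ᵥ (b₀ - U₀ *ᵥ w)
      let x₁ := A₁₁⁻¹ *ᵥ (b₁ - U₁ *ᵥ z)
      A *ᵥ Sum.elim x₀ x₁ = Sum.elim b₀ b₁ ∧
      ∀ (y₀ : Fin m₀ → ℝ) (y₁ : Fin m₁ → ℝ),
        A *ᵥ Sum.elim y₀ y₁ = Sum.elim b₀ b₁ → y₀ = x₀ ∧ y₁ = x₁ := by
  have hd₀ : IsUnit A₀₀.det := (isUnit_iff_isUnit_det _).1 hA₀₀
  have hd₁ : IsUnit A₁₁.det := (isUnit_iff_isUnit_det _).1 hA₁₁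
  have hdS : IsUnit (1 - C₁ * C₀).det := (isUnit_iff_isUnit_det _).1 hS
  have solves : ∀ (b₀ : Fin m₀ → ℝ) (b₁ : Fin m₁ → ℝ),
      let g₀ := V₀ᵀ *ᵥ (A₀₀⁻¹ *ᵥ b₀)
      let g₁ := V₁ᵀ *ᵥ (A₁₁⁻¹ *ᵥ b₁)
      let w := (1 - C₁ * C₀)⁻¹ *ᵥ (g₁ - C₁ *ᵥ g₀)
      let z := g₀ - C₀ *ᵥ w
      let x₀ := A₀₀⁻¹ *ᵥ (b₀ - U₀ *ᵥ w)
      let x₁ := A₁₁⁻¹ *ᵥ (b₁ - U₁ *ᵥ z)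
      A *ᵥ Sum.elim x₀ x₁ = Sum.elim b₀ b₁ := by
    intro b₀ b₁ g₀ g₁ w z x₀ x₁
    have hw : w - C₁ *ᵥ (C₀ *ᵥ w) = g₁ - C₁ *ᵥ g₀ := by
      have h : (1 - C₁ * C₀) *ᵥ w = g₁ - C₁ *ᵥ g₀ := by
        simp only [w, mulVec_mulVec, mul_nonsing_inv _ hdS, one_mulVec]
      rwa [sub_mulVec, one_mulVec, ← mulVec_mulVec] at h
    have hz : V₀ᵀ *ᵥ x₀ = z := by
      simp only [x₀, z, g₀, hC₀, mulVec_sub, mulVec_mulVec, Matrix.mul_assoc]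
    have hx₁ : V₁ᵀ *ᵥ x₁ = w := by
      have h : V₁ᵀ *ᵥ x₁ = g₁ - C₁ *ᵥ z := by
        simp only [x₁, g₁, hC₁, mulVec_sub, mulVec_mulVec, Matrix.mul_assoc]
      rw [h, mulVec_sub, ← sub_add, ← hw, sub_add_cancel]
    have hb₀ : A₀₀ *ᵥ x₀ = b₀ - U₀ *ᵥ w := by
      simp only [x₀, mulVec_mulVec _ A₀₀, mul_nonsing_inv _ hd₀, one_mulVec]
    have hb₁ : A₁₁ *ᵥ x₁ = b₁ - U₁ *ᵥ z := by
      simp only [x₁, mulVec_mulVec _ A₁₁, mul_nonsing_inv _ hd₁, one_mulVec]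
    rw [hA, fromBlocks_mulVec, Sum.elim_comp_inl, Sum.elim_comp_inr, ← mulVec_mulVec,
      ← mulVec_mulVec, hz, hx₁, hb₀, hb₁, sub_add_cancel, add_sub_cancel]
  have hU : IsUnit A := mulVec_surjective_iff_isUnit.1 fun b =>
    ⟨_, (solves (b ∘ Sum.inl) (b ∘ Sum.inr)).trans (Sum.elim_comp_inl_inr b)⟩
  refine ⟨hU, fun b₀ b₁ => ⟨solves b₀ b₁, fun y₀ y₁ hy => ?_⟩⟩
  have h := mulVec_injective_iff_isUnit.2 hU (hy.trans (solves b₀ b₁).symm)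
  exact ⟨congrArg (· ∘ Sum.inl) h, congrArg (· ∘ Sum.inr) h⟩
end
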